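/- (Customized Fulks Laplace-method sandwich.) Fix q ∈ (1,2) and b > 0, and let f be a density on [0, b], continuous on (0, b], with f(λ) = f₀ λ^{q/2 − 1} + O(λ^{q/2}) as λ → 0⁺, f₀ > 0. Let (s_n) and (v_n) be sequences with s_n → ∞, v_n → ∞, s_n/v_n → 0, and v_n^{1/q}/s_n → 0. Define m_n ≐ ∫_0^{b} exp(λ s_n − λ^q v_n) f(λ) dλ and A_n ≐ (2/q) f₀ √(2πq/(4(q−1) v_n)) · exp( c(q) (s_n / v_n^{1/q})^{q/(q−1)} ), where c(q) ≐ (1/q)^{1/(q−1)} − (1/q)^{q/(q−1)} > 0. Then liminf_{n→∞} m_n / A_n ≥ 1 and limsup_{n→∞} m_n / A_n ≤ 1/(2√(1 − log 2)) + q/(4(q−1)). -/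

import Mathlib

open Real Filter Asymptotics MeasureTheory intervalIntegral

/-- The normalised phase `x² - q x^(2/q) + (q - 1)`, whose minimum on `[0, ∞)` is `0`,
attained at `x = 1`. -/
noncomputable def laplacePhase (q x : ℝ) : ℝ := x ^ 2 - q * x ^ (2 / q) + (q - 1)

lemma measurable_laplacePhase (q : ℝ) : Measurable (laplacePhase q) := by
  unfold laplacePhase
  fun_prop

lemma mul_sq_le_laplacePhase {q x : ℝ} (hq : q ∈ Set.Ioo (1 : ℝ) 2) (hx : 0 < x) :
    (q - 1) * (x - 1) ^ 2 ≤ laplacePhase q x := by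
  obtain ⟨h1, h2⟩ := hq
  have hq0 : 0 < q := by linarith
  have hp1 : 1 ≤ 2 / q := by rw [le_div_iff₀ hq0]; linarith
  have hp2 : 2 / q ≤ 2 := by rw [div_le_iff₀ hq0]; linarith
  have hbern : x ^ (2 / q - 1) ≤ 1 + (2 / q - 1) * (x - 1) := by
    have := rpow_one_add_le_one_add_mul_self (s := x - 1) (by linarith) (p := 2 / q - 1)
      (by linarith) (by linarith)
    simpa using this
  have hpow : x ^ (2 / q) = x * x ^ (2 / q - 1) := by
    rw [rpow_sub_one hx.ne', mul_div_cancel₀ _ hx.ne']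
  have hmul : q * x ^ (2 / q) ≤ q * x * (1 + (2 / q - 1) * (x - 1)) := by
    rw [hpow, ← mul_assoc]
    exact mul_le_mul_of_nonneg_left hbern (by positivity)
  have hexpand : q * x * (1 + (2 / q - 1) * (x - 1)) = q * x + (2 - q) * x * (x - 1) := by
    field_simp
  unfold laplacePhase
  nlinarith

lemma tendsto_laplacePhase_div_sq {q : ℝ} (hq : 0 < q) :
    Tendsto (fun h => laplacePhase q (1 + h) / h ^ 2) (nhdsWithin 0 {0}ᶜ)
      (nhds (2 - 2 / q)) := by
  have hone : ∀ᶠ h : ℝ in nhdsWithin 0 {0}ᶜ, 0 < 1 + h :=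
    eventually_nhdsWithin_of_eventually_nhds <|
      (eventually_gt_nhds (show (-1 : ℝ) < 0 by norm_num)).mono fun h hh => by linarith
  refine HasDerivAt.lhopital_zero_nhdsNE
    (f' := fun h => 2 * (1 + h) - 2 * (1 + h) ^ (2 / q - 1)) (g' := fun h => 2 * h)
    ?_ ?_ ?_ ?_ ?_ ?_
  · filter_upwards [hone] with h hh
    have hd : HasDerivAt (fun h : ℝ => 1 + h) 1 h := (hasDerivAt_id h).const_add 1
    have h3 := ((hd.pow 2).sub ((hd.rpow_const (p := 2 / q) (Or.inl hh.ne')).const_mul q)).add_const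
      (q - 1)
    refine h3.congr_deriv ?_
    field_simp
    simp
    ring
  · refine Eventually.of_forall fun h => ?_
    simpa using hasDerivAt_pow 2 h
  · filter_upwards [self_mem_nhdsWithin] with h hh
    simpa using hh
  · refine tendsto_nhdsWithin_of_tendsto_nhds ?_
    have : ContinuousAt (fun h : ℝ => laplacePhase q (1 + h)) 0 := by
      unfold laplacePhase
      have : ContinuousAt (fun h : ℝ => (1 + h) ^ (2 / q)) 0 :=
        ContinuousAt.rpow_const (by fun_prop) (by simp)
      fun_prop
    simpa [laplacePhase, ContinuousAt] using this
  · refine tendsto_nhdsWithin_of_tendsto_nhds ?_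
    have : ContinuousAt (fun h : ℝ => h ^ 2) 0 := by fun_prop
    simpa [ContinuousAt] using this
  · have hd : HasDerivAt (fun h : ℝ => 1 + h) 1 0 := (hasDerivAt_id (0 : ℝ)).const_add 1
    have h3 : HasDerivAt (fun h : ℝ => (1 + h) - (1 + h) ^ (2 / q - 1)) (2 - 2 / q) 0 := by
      refine (hd.sub (hd.rpow_const (p := 2 / q - 1) (Or.inl (by norm_num)))).congr_deriv ?_
      simp
      ring
    rw [hasDerivAt_iff_tendsto_slope] at h3
    refine h3.congr' ?_
    filter_upwards [self_mem_nhdsWithin] with h hh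
    have : h ≠ 0 := by simpa using hh
    simp only [slope_def_field]
    simp
    field_simp

lemma tendsto_sq_mul_laplacePhase {q : ℝ} (hq : 0 < q) {R : ℕ → ℝ} (hR : Tendsto R atTop atTop)
    (w : ℝ) :
    Tendsto (fun n => R n ^ 2 * laplacePhase q (1 + w / R n)) atTop
      (nhds ((2 - 2 / q) * w ^ 2)) := by
  rcases eq_or_ne w 0 with rfl | hw
  · simp [laplacePhase]
  have hpos := hR.eventually_gt_atTop 0
  have hlim : Tendsto (fun n => w / R n) atTop (nhdsWithin 0 {0}ᶜ) := by
    refine tendsto_nhdsWithin_iff.2 ⟨hR.const_div_atTop w, ?_⟩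
    filter_upwards [hpos] with n hn
    simp [hw, hn.ne']
  refine (((tendsto_laplacePhase_div_sq hq).comp hlim).mul_const (w ^ 2)).congr' ?_
  filter_upwards [hpos] with n hn
  simp only [Function.comp]
  field_simp

/-- Laplace's method for the rescaled integral: dominated convergence to a Gaussian integral. -/
lemma tendsto_integral_exp_neg_laplacePhase {q M f₀ : ℝ} (hq : q ∈ Set.Ioo (1 : ℝ) 2)
    {H : ℝ → ℝ} (hH : Measurable H) (hHM : ∀ t, |H t| ≤ M) (hH0 : ∀ t ≤ 0, H t = 0)
    (hHf : Tendsto H (nhdsWithin 0 (Set.Ioi 0)) (nhds f₀)) {τ R : ℕ → ℝ}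
    (hτ : Tendsto τ atTop (nhdsWithin 0 (Set.Ioi 0))) (hR : Tendsto R atTop atTop) :
    Tendsto (fun n => ∫ w, Real.exp (-(R n ^ 2 * laplacePhase q (1 + w / R n))) *
        H (τ n * (1 + w / R n))) atTop (nhds (f₀ * Real.sqrt (π / (2 - 2 / q)))) := by
  have hq1 := hq.1
  have hq0 : 0 < q := by linarith
  have hτ' := tendsto_nhdsWithin_iff.1 hτ
  have hτpos : ∀ᶠ n in atTop, 0 < τ n := hτ'.2
  have hRpos := hR.eventually_gt_atTop 0
  rw [← integral_gaussian, ← MeasureTheory.integral_const_mul]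
  refine tendsto_integral_filter_of_dominated_convergence
    (fun w => M * Real.exp (-(q - 1) * w ^ 2)) ?_ ?_ ?_ ?_
  · refine Eventually.of_forall fun n => Measurable.aestronglyMeasurable ?_
    have := measurable_laplacePhase q
    fun_prop
  · filter_upwards [hτpos, hRpos] with n hτn hRn
    refine Eventually.of_forall fun w => ?_
    have hM : 0 ≤ M := (abs_nonneg _).trans (hHM 0)
    rcases le_or_gt (1 + w / R n) 0 with hx | hx
    · rw [hH0 _ (mul_nonpos_of_nonneg_of_nonpos hτn.le hx)]
      simp only [mul_zero, norm_zero]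
      positivity
    · rw [norm_mul, norm_of_nonneg (exp_pos _).le, Real.norm_eq_abs, mul_comm]
      refine mul_le_mul (hHM _) (exp_le_exp.2 ?_) (exp_pos _).le hM
      have h1 := mul_le_mul_of_nonneg_left (mul_sq_le_laplacePhase hq hx) (sq_nonneg (R n))
      have h2 : R n ^ 2 * ((q - 1) * (1 + w / R n - 1) ^ 2) = (q - 1) * w ^ 2 := by
        field_simp
        ring
      linarith
  · exact (integrable_exp_neg_mul_sq (by linarith)).const_mul M
  · refine Eventually.of_forall fun w => ?_
    have hx : Tendsto (fun n => 1 + w / R n) atTop (nhds 1) := by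
      simpa using (hR.const_div_atTop w).const_add 1
    have ht : Tendsto (fun n => τ n * (1 + w / R n)) atTop (nhdsWithin 0 (Set.Ioi 0)) := by
      refine tendsto_nhdsWithin_iff.2 ⟨by simpa using hτ'.1.mul hx, ?_⟩
      filter_upwards [hτpos, hx.eventually_const_lt zero_lt_one] with n h1 h2
      exact mul_pos h1 h2
    have hexp := (continuous_exp.tendsto _).comp (tendsto_sq_mul_laplacePhase hq0 hR w).neg
    rw [neg_mul, mul_comm f₀]
    exact hexp.mul (hHf.comp ht)

/-- The density in the variable `t = λ^(q/2)`, up to the factor `2 / q`. -/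
noncomputable def rpowDensity (q b : ℝ) (f : ℝ → ℝ) : ℝ → ℝ :=
  (Set.Ioc 0 (b ^ (q / 2))).indicator fun t => t ^ (2 / q - 1) * f (t ^ (2 / q))

lemma rpow_mem_Ioc_iff {q b t : ℝ} (hq : 0 < q) (hb : 0 < b) (ht : 0 < t) :
    t ^ (2 / q) ∈ Set.Ioc 0 b ↔ t ∈ Set.Ioc 0 (b ^ (q / 2)) := by
  have h := rpow_le_rpow_iff (z := 2 / q) ht.le (rpow_nonneg hb.le (q / 2)) (by positivity)
  rw [← rpow_mul hb.le, show q / 2 * (2 / q) = 1 by field_simp, rpow_one] at h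
  simp [ht, rpow_pos_of_pos ht, h]

lemma continuousOn_rpow_mul_comp_rpow {q b : ℝ} {f : ℝ → ℝ} (hq : 0 < q) (hb : 0 < b)
    (hf : ContinuousOn f (Set.Ioc 0 b)) :
    ContinuousOn (fun t => t ^ (2 / q - 1) * f (t ^ (2 / q))) (Set.Ioc 0 (b ^ (q / 2))) := by
  have hpow : ∀ a : ℝ, ContinuousOn (fun t : ℝ => t ^ a) (Set.Ioc 0 (b ^ (q / 2))) :=
    fun a => continuousOn_id.rpow_const fun t ht => Or.inl ht.1.ne'
  exact (hpow _).mul (hf.comp (hpow _) fun t ht => (rpow_mem_Ioc_iff hq hb ht.1).2 ht)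

lemma measurable_rpowDensity {q b : ℝ} {f : ℝ → ℝ} (hq : 0 < q) (hb : 0 < b)
    (hf : ContinuousOn f (Set.Ioc 0 b)) : Measurable (rpowDensity q b f) := by
  classical
  rw [rpowDensity, ← Set.piecewise_eq_indicator]
  exact (continuousOn_rpow_mul_comp_rpow hq hb hf).measurable_piecewise continuousOn_const
    measurableSet_Ioc

lemma tendsto_rpowDensity {q b f₀ : ℝ} {f : ℝ → ℝ} (hq : 0 < q) (hb : 0 < b)
    (hf : (fun l => f l - f₀ * l ^ (q / 2 - 1))
      =O[nhdsWithin 0 (Set.Ioi 0)] fun l => l ^ (q / 2)) :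
    Tendsto (rpowDensity q b f) (nhdsWithin 0 (Set.Ioi 0)) (nhds f₀) := by
  have hp : 0 < 2 / q := by positivity
  have hpow : Tendsto (fun t : ℝ => t ^ (2 / q)) (nhdsWithin 0 (Set.Ioi 0)) (nhds 0) := by
    have := (continuousAt_rpow_const (0 : ℝ) (2 / q) (Or.inr hp.le)).tendsto
    rw [zero_rpow hp.ne'] at this
    exact tendsto_nhdsWithin_of_tendsto_nhds this
  have hpow' : Tendsto (fun t : ℝ => t ^ (2 / q)) (nhdsWithin 0 (Set.Ioi 0))
      (nhdsWithin 0 (Set.Ioi 0)) := by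
    refine tendsto_nhdsWithin_iff.2 ⟨hpow, ?_⟩
    filter_upwards [self_mem_nhdsWithin] with t ht using rpow_pos_of_pos ht _
  have hO := ((isBigO_refl (fun t : ℝ => t ^ (2 / q - 1)) _).mul (hf.comp_tendsto hpow')).congr'
    (f₂ := fun t => rpowDensity q b f t - f₀) (g₂ := fun t => t ^ (2 / q)) ?_ ?_
  · have := hO.trans_tendsto hpow
    simpa using this.add_const f₀
  · filter_upwards [Ioc_mem_nhdsGT (rpow_pos_of_pos hb (q / 2))] with t ht
    have ht0 := ht.1
    rw [rpowDensity, Set.indicator_of_mem ht]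
    simp only [Function.comp]
    rw [mul_sub, ← rpow_mul ht0.le, mul_left_comm, ← rpow_add ht0,
      show 2 / q - 1 + 2 / q * (q / 2 - 1) = 0 by field_simp; ring, rpow_zero, mul_one]
  · filter_upwards [self_mem_nhdsWithin] with t ht
    simp only [Function.comp]
    rw [← rpow_mul (le_of_lt ht), ← rpow_add ht]
    congr 1
    field_simp
    ring

lemma exists_abs_rpowDensity_le {q b f₀ : ℝ} {f : ℝ → ℝ} (hq : 0 < q) (hb : 0 < b)
    (hf_cont : ContinuousOn f (Set.Ioc 0 b))
    (hf : (fun l => f l - f₀ * l ^ (q / 2 - 1))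
      =O[nhdsWithin 0 (Set.Ioi 0)] fun l => l ^ (q / 2)) :
    ∃ M, ∀ t, |rpowDensity q b f t| ≤ M := by
  have hnear := (tendsto_rpowDensity hq hb hf).abs.eventually_le_const (lt_add_one |f₀|)
  obtain ⟨δ, hδ, hnear⟩ := mem_nhdsGT_iff_exists_Ioo_subset.1 hnear
  obtain ⟨C, hC⟩ := (isCompact_Icc (a := δ) (b := b ^ (q / 2))).exists_bound_of_continuousOn
    ((continuousOn_rpow_mul_comp_rpow hq hb hf_cont).mono
      (Set.Icc_subset_Ioc (Set.mem_Ioi.1 hδ) le_rfl))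
  refine ⟨max (|f₀| + 1) C, fun t => ?_⟩
  by_cases ht : t ∈ Set.Ioc 0 (b ^ (q / 2))
  · rcases lt_or_ge t δ with h | h
    · exact (hnear ⟨ht.1, h⟩).trans (le_max_left _ _)
    · rw [rpowDensity, Set.indicator_of_mem ht]
      exact (hC t ⟨h, ht.2⟩).trans (le_max_right _ _)
  · rw [rpowDensity, Set.indicator_of_notMem ht, abs_zero]
    exact le_max_of_le_left (by positivity)

lemma integral_eq_integral_rpowDensity {q b : ℝ} (hq : 0 < q) (hb : 0 < b) (f : ℝ → ℝ)
    (s v : ℝ) :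
    (∫ l in (0 : ℝ)..b, Real.exp (l * s - l ^ q * v) * f l) =
      2 / q * ∫ t, Real.exp (t ^ (2 / q) * s - t ^ 2 * v) * rpowDensity q b f t := by
  have hp : 0 < 2 / q := by positivity
  have hinter : Set.Ioi 0 ∩ Set.Ioc 0 b = Set.Ioc 0 b :=
    Set.inter_eq_right.2 Set.Ioc_subset_Ioi_self
  rw [integral_of_le hb.le, ← hinter,
    ← setIntegral_indicator measurableSet_Ioc, ← integral_comp_rpow_Ioi _ hp.ne',
    ← MeasureTheory.integral_const_mul, ← MeasureTheory.integral_indicator measurableSet_Ioi]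
  congr 1 with t
  by_cases ht : t ∈ Set.Ioi (0 : ℝ)
  · have ht0 : 0 < t := ht
    rw [Set.indicator_of_mem ht, abs_of_pos hp, smul_eq_mul, rpowDensity]
    by_cases htb : t ∈ Set.Ioc 0 (b ^ (q / 2))
    · rw [Set.indicator_of_mem htb, Set.indicator_of_mem ((rpow_mem_Ioc_iff hq hb ht0).2 htb),
        ← rpow_mul ht0.le, div_mul_cancel₀ _ hq.ne', rpow_two]
      ring
    · rw [Set.indicator_of_notMem htb,
        Set.indicator_of_notMem (mt (rpow_mem_Ioc_iff hq hb ht0).1 htb)]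
      simp
  · rw [Set.indicator_of_notMem ht, rpowDensity, Set.indicator_of_notMem fun h => ht h.1]
    simp

/-- Centering the exponent at its maximiser `τ` and rescaling by `τ / R = v^(-1/2)`. -/
lemma integral_exp_mul_eq_rescaled {q s v τ R : ℝ} {H : ℝ → ℝ} (hH0 : ∀ t ≤ 0, H t = 0)
    (hτ : 0 < τ) (hR : 0 < R) (hv : τ ^ 2 * v = R ^ 2) (hs : τ ^ (2 / q) * s = q * R ^ 2) :
    (∫ t, Real.exp (t ^ (2 / q) * s - t ^ 2 * v) * H t) =
      τ / R * Real.exp ((q - 1) * R ^ 2) *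
        ∫ w, Real.exp (-(R ^ 2 * laplacePhase q (1 + w / R))) * H (τ * (1 + w / R)) := by
  have hpos : 0 < τ / R := by positivity
  set g : ℝ → ℝ := fun t => Real.exp (t ^ (2 / q) * s - t ^ 2 * v) * H t
  have hscale := Measure.integral_comp_mul_left (fun t => g (t + τ)) (τ / R)
  rw [integral_add_right_eq_self g τ, abs_of_pos (by positivity), smul_eq_mul] at hscale
  have hg : ∫ t, g t = τ / R * ∫ w, g (τ / R * w + τ) := by
    rw [hscale, mul_inv_cancel_left₀ hpos.ne']
  rw [hg, mul_assoc, ← MeasureTheory.integral_const_mul (Real.exp _)]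
  congr 2 with w
  have ht : τ / R * w + τ = τ * (1 + w / R) := by field_simp; ring
  simp only [g, ht]
  set x := 1 + w / R
  rcases le_or_gt x 0 with hx | hx
  · simp [hH0 _ (mul_nonpos_of_nonneg_of_nonpos hτ.le hx)]
  · rw [← mul_assoc, ← Real.exp_add, mul_rpow hτ.le hx.le, laplacePhase]
    congr 2
    linear_combination x ^ (2 / q) * hs - x ^ 2 * hv

lemma one_le_inv_two_mul_sqrt_add {q : ℝ} (hq : q ∈ Set.Ioo (1 : ℝ) 2) :
    1 ≤ 1 / (2 * Real.sqrt (1 - Real.log 2)) + q / (4 * (q - 1)) := by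
  obtain ⟨h1, h2⟩ := hq
  have hlog : Real.log 2 < 1 := by linarith [Real.log_two_lt_d9]
  have hlog' := Real.log_two_gt_d9
  have hsqrt : 0 < Real.sqrt (1 - Real.log 2) := Real.sqrt_pos.2 (by linarith)
  have hsqrt1 : Real.sqrt (1 - Real.log 2) ≤ 1 := Real.sqrt_le_one.2 (by linarith)
  have hfst : 1 / 2 ≤ 1 / (2 * Real.sqrt (1 - Real.log 2)) :=
    one_div_le_one_div_of_le (by positivity) (by linarith)
  have hsnd : 1 / 2 ≤ q / (4 * (q - 1)) := by
    rw [div_le_div_iff₀ (by norm_num) (by linarith)]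
    linarith
  linarith

lemma one_div_rpow_sub_one_div_rpow {q : ℝ} (hq : 1 < q) :
    (1 / q) ^ (1 / (q - 1)) - (1 / q) ^ (q / (q - 1)) = (q - 1) * (1 / q) ^ (q / (q - 1)) := by
  have hq0 : 0 < q := by linarith
  have hq1 : q - 1 ≠ 0 := by linarith
  rw [show q / (q - 1) = 1 / (q - 1) + 1 by field_simp; ring, rpow_add_one (by positivity)]
  field_simp

/-- **Customized Fulks Laplace-method sandwich.** Fix `q ∈ (1,2)`, `b > 0`, a density
`f` on `[0,b]` continuous on `(0,b]` with `f(λ) = f₀ λ^{q/2−1} + O(λ^{q/2})`, `f₀ > 0`.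
For sequences `s_n, v_n → ∞` with `s_n/v_n → 0` and `v_n^{1/q}/s_n → 0`, the mixture
wealth `m_n = ∫₀^b exp(λ s_n − λ^q v_n) f(λ) dλ` compared with
`A_n = (2/q) f₀ √(2πq/(4(q−1)v_n)) exp(c(q)(s_n/v_n^{1/q})^{q/(q−1)})`, where
`c(q) = (1/q)^{1/(q−1)} − (1/q)^{q/(q−1)} > 0`, satisfies
`liminf m_n/A_n ≥ 1` and `limsup m_n/A_n ≤ 1/(2√(1−log 2)) + q/(4(q−1))`. -/
theorem fulks_laplace_sandwich
    (q b f₀ : ℝ) (hq : q ∈ Set.Ioo (1 : ℝ) 2) (hb : 0 < b) (hf₀ : 0 < f₀)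
    (f : ℝ → ℝ)
    (hf_nonneg : ∀ l ∈ Set.Icc 0 b, 0 ≤ f l)
    (hf_prob : (∫ l in (0 : ℝ)..b, f l) = 1)
    (hf_cont : ContinuousOn f (Set.Ioc 0 b))
    (hf_asymp : (fun l => f l - f₀ * l ^ (q / 2 - 1))
      =O[nhdsWithin 0 (Set.Ioi 0)] fun l => l ^ (q / 2))
    (s v : ℕ → ℝ)
    (hs : Tendsto s atTop atTop) (hv : Tendsto v atTop atTop)
    (hsv : Tendsto (fun n => s n / v n) atTop (nhds 0))
    (hvs : Tendsto (fun n => v n ^ (1 / q) / s n) atTop (nhds 0))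
    (c : ℝ) (hc : c = (1 / q) ^ (1 / (q - 1)) - (1 / q) ^ (q / (q - 1)))
    (m A : ℕ → ℝ)
    (hm : ∀ n, m n = ∫ l in (0 : ℝ)..b, Real.exp (l * s n - l ^ q * v n) * f l)
    (hA : ∀ n, A n = (2 / q) * f₀ * Real.sqrt (2 * π * q / (4 * (q - 1) * v n))
      * Real.exp (c * (s n / v n ^ (1 / q)) ^ (q / (q - 1)))) :
    0 < c ∧
    1 ≤ Filter.liminf (fun n => m n / A n) atTop ∧
    Filter.limsup (fun n => m n / A n) atTop ≤
      1 / (2 * Real.sqrt (1 - Real.log 2)) + q / (4 * (q - 1)) := by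
  have hq1 := hq.1
  have hq0 : 0 < q := by linarith
  have hq1' : 0 < q - 1 := by linarith
  have hc' : c = (q - 1) * (1 / q) ^ (q / (q - 1)) := hc.trans (one_div_rpow_sub_one_div_rpow hq1)
  set τ : ℕ → ℝ := fun n => (s n / v n / q) ^ (q / (2 * (q - 1))) with hτdef
  set R : ℕ → ℝ := fun n => τ n * Real.sqrt (v n) with hRdef
  have hspos := hs.eventually_gt_atTop 0
  have hvpos := hv.eventually_gt_atTop 0
  have hτpos : ∀ᶠ n in atTop, 0 < τ n := by
    filter_upwards [hspos, hvpos] with n h1 h2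
    positivity
  have hτ : Tendsto τ atTop (nhdsWithin 0 (Set.Ioi 0)) := by
    refine tendsto_nhdsWithin_iff.2 ⟨?_, hτpos⟩
    have hexp : 0 < q / (2 * (q - 1)) := by positivity
    have := (hsv.div_const q).rpow_const (p := q / (2 * (q - 1))) (Or.inr hexp.le)
    rwa [zero_div, zero_rpow hexp.ne'] at this
  have hRsq : ∀ᶠ n in atTop,
      R n ^ 2 = (1 / q) ^ (q / (q - 1)) * (s n / v n ^ (1 / q)) ^ (q / (q - 1)) := by
    filter_upwards [hspos, hvpos] with n h1 h2
    have hdiv : v n = (v n ^ (1 / q) / v n) ^ (-(q / (q - 1))) := by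
      rw [← rpow_sub_one h2.ne', ← rpow_mul h2.le,
        show (1 / q - 1) * -(q / (q - 1)) = 1 by field_simp; ring, rpow_one]
    have hτsq : τ n ^ 2 = (s n / v n / q) ^ (q / (q - 1)) := by
      rw [← rpow_natCast, ← rpow_mul (by positivity)]
      congr 1
      push_cast
      field_simp
    rw [hRdef, mul_pow, sq_sqrt h2.le, hτsq]
    nth_rewrite 2 [hdiv]
    rw [rpow_neg (by positivity), ← div_eq_mul_inv, ← div_rpow (by positivity) (by positivity),
      ← mul_rpow (by positivity) (by positivity)]
    congr 1
    field_simp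
  have hR : Tendsto R atTop atTop := by
    have hratio : Tendsto (fun n => s n / v n ^ (1 / q)) atTop atTop := by
      refine (Tendsto.inv_tendsto_nhdsGT_zero (tendsto_nhdsWithin_iff.2 ⟨hvs, ?_⟩)).congr
        fun n => by simp
      filter_upwards [hspos, hvpos] with n h1 h2
      exact div_pos (rpow_pos_of_pos h2 _) h1
    have hsq : Tendsto (fun n => R n ^ 2) atTop atTop :=
      (((tendsto_rpow_atTop (y := q / (q - 1)) (by positivity)).comp hratio).const_mul_atTop
        (r := (1 / q) ^ (q / (q - 1))) (by positivity)).congr' (hRsq.mono fun n h => h.symm)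
    refine (Real.tendsto_sqrt_atTop.comp hsq).congr' ?_
    filter_upwards [hτpos] with n hn
    exact Real.sqrt_sq (by positivity)
  obtain ⟨M, hM⟩ := exists_abs_rpowDensity_le hq0 hb hf_cont hf_asymp
  have hH0 : ∀ t ≤ 0, rpowDensity q b f t = 0 := fun t ht =>
    Set.indicator_of_notMem (fun h => absurd h.1 ht.not_gt) _
  have hden : 0 < 2 - 2 / q := by
    rw [sub_pos, div_lt_iff₀ hq0]
    linarith
  have hlim := (tendsto_integral_exp_neg_laplacePhase hq (measurable_rpowDensity hq0 hb hf_cont) hM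
    hH0 (tendsto_rpowDensity hq0 hb hf_asymp) hτ hR).div_const (f₀ * Real.sqrt (π / (2 - 2 / q)))
  rw [div_self (by positivity)] at hlim
  have hratio : Tendsto (fun n => m n / A n) atTop (nhds 1) := by
    refine hlim.congr' ?_
    filter_upwards [hspos, hvpos, hτpos, hRsq] with n h1 h2 h3 h4
    have hRn : 0 < R n := by positivity
    have hv' : τ n ^ 2 * v n = R n ^ 2 := by rw [hRdef, mul_pow, sq_sqrt h2.le]
    have hs' : τ n ^ (2 / q) * s n = q * R n ^ 2 := by
      have hpow : τ n ^ 2 = τ n ^ (2 / q) * (s n / v n / q) := by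
        rw [hτdef, ← rpow_natCast, ← rpow_mul (by positivity), ← rpow_mul (by positivity),
          ← rpow_add_one (by positivity)]
        congr 1
        push_cast
        field_simp
        ring
      rw [← hv', hpow]
      field_simp
    have hexp : c * (s n / v n ^ (1 / q)) ^ (q / (q - 1)) = (q - 1) * R n ^ 2 := by
      rw [hc', h4, mul_assoc]
    have hsqrt : Real.sqrt (2 * π * q / (4 * (q - 1) * v n)) =
        τ n / R n * Real.sqrt (π / (2 - 2 / q)) := by
      rw [show 2 * π * q / (4 * (q - 1) * v n) = π / (2 - 2 / q) / v n by
        have : q * 2 - 2 ≠ 0 := by linarith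
        field_simp
        ring, sqrt_div (by positivity), hRdef]
      field_simp
    rw [hm, hA, hexp, hsqrt, integral_eq_integral_rpowDensity hq0 hb,
      integral_exp_mul_eq_rescaled hH0 h3 hRn hv' hs']
    generalize (∫ w : ℝ, _ : ℝ) = I
    field_simp
  refine ⟨?_, hratio.liminf_eq.ge, hratio.limsup_eq.trans_le (one_le_inv_two_mul_sqrt_add hq)⟩
  rw [hc']
  positivity
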